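/- arXiv:1505.02323 — 4 statements merged into one kernel-verified Lean document; each statement's English description precedes it below -/
import Mathlib

section
/- The semidirect product (ℤ/11ℤ) ⋊_4 ℤ, in which the generator 1 of ℤ acts on the additive group ℤ/11ℤ by multiplication by 4, is not isomorphic as a group to the semidirect product (ℤ/11ℤ) ⋊_9 ℤ, in which the generator 1 of ℤ acts on ℤ/11ℤ by multiplication by 9. -/
/-- Multiplication by a unit `b` of `ZMod m`, as a multiplicative automorphism of the (additive,
written multiplicatively) group `ZMod m`. -/
def unitMulAut {m : ℕ} (b : (ZMod m)ˣ) : MulAut (Multiplicative (ZMod m)) :=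
  AddEquiv.toMultiplicative (AddAut.mulLeft b)

/-- The semidirect product `(ℤ/mℤ) ⋊_b ℤ` in which the generator `1` of `ℤ` acts on the additive
group `ℤ/mℤ` by multiplication by the unit `b`. -/
abbrev zmodSemidirectZ (m : ℕ) (b : (ZMod m)ˣ) : Type :=
  Multiplicative (ZMod m) ⋊[zpowersHom (MulAut (Multiplicative (ZMod m))) (unitMulAut b)]
    Multiplicative ℤ

namespace zmodSemidirectZ

open SemidirectProduct Multiplicative

variable {m : ℕ} {b c : (ZMod m)ˣ}

theorem unitMulAut_apply (b : (ZMod m)ˣ) (x : Multiplicative (ZMod m)) :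
    unitMulAut b x = ofAdd ((b : ZMod m) * x.toAdd) := rfl

theorem unitMulAut_inv (b : (ZMod m)ˣ) : (unitMulAut b)⁻¹ = unitMulAut b⁻¹ := by
  rw [inv_eq_iff_mul_eq_one]
  ext x
  simp [unitMulAut_apply]

theorem inl_pow_card (x : Multiplicative (ZMod m)) :
    (inl x : zmodSemidirectZ m b) ^ m = 1 := by
  have hx : x ^ m = 1 := by
    apply toAdd.injective
    simp
  rw [← map_pow, hx, map_one]

/-- The elements of finite order dividing `m` are those of the normal factor `ℤ/mℤ`. -/
theorem right_eq_one_of_pow_eq_one [NeZero m] {x : zmodSemidirectZ m b} (hx : x ^ m = 1) :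
    x.right = 1 := by
  have h : (rightHom x) ^ m = 1 := by rw [← map_pow, hx, map_one]
  have h' : (m : ℤ) * x.right.toAdd = 0 := by
    simpa using congrArg toAdd h
  apply toAdd.injective
  simpa [NeZero.ne m] using h'

theorem eq_inl_left_of_pow_eq_one [NeZero m] {x : zmodSemidirectZ m b} (hx : x ^ m = 1) :
    x = inl x.left := by
  ext
  · simp
  · simp [right_eq_one_of_pow_eq_one hx]

/-- An isomorphism maps the generator of `ℤ` to an element projecting to a generator of `ℤ`. -/
theorem isUnit_right_map_inr [NeZero m] (f : zmodSemidirectZ m b ≃* zmodSemidirectZ m c) :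
    IsUnit (f (inr (ofAdd 1))).right.toAdd := by
  obtain ⟨x, hx⟩ := f.surjective (inr (ofAdd 1))
  have hxr : x.right = ofAdd 1 ^ x.right.toAdd := by
    apply toAdd.injective
    simp
  have hl : (f (inl x.left)).right = 1 :=
    right_eq_one_of_pow_eq_one (by rw [← map_pow, inl_pow_card, map_one])
  have h : rightHom (f (inl x.left * inr (ofAdd 1) ^ x.right.toAdd)) = ofAdd 1 := by
    rw [← map_zpow, ← hxr, inl_left_mul_inr_right, hx, rightHom_inr]
  rw [map_mul, map_zpow, map_mul, map_zpow, rightHom_eq_right, hl, one_mul] at h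
  have h' : x.right.toAdd * (f (inr (ofAdd 1))).right.toAdd = 1 := by
    simpa using congrArg toAdd h
  exact IsUnit.of_mul_eq_one_right _ h'

theorem conj_inl (t : zmodSemidirectZ m c) (x : Multiplicative (ZMod m)) :
    t * inl x * t⁻¹ = inl ((unitMulAut c ^ t.right.toAdd) x) := by
  have h : (unitMulAut c ^ t.right.toAdd) x =
      zpowersHom (MulAut (Multiplicative (ZMod m))) (unitMulAut c) t.right x := rfl
  rw [h]
  ext
  · simp [mul_comm]
  · simp

/-- If `(ℤ/mℤ) ⋊_b ℤ` and `(ℤ/mℤ) ⋊_c ℤ` are isomorphic, then `b = c` or `b = c⁻¹`. -/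
theorem eq_or_eq_inv_of_mulEquiv [NeZero m]
    (f : zmodSemidirectZ m b ≃* zmodSemidirectZ m c) : b = c ∨ b = c⁻¹ := by
  set y : zmodSemidirectZ m b := f.symm (inl (ofAdd 1)) with hy
  have hyl : y = inl y.left :=
    eq_inl_left_of_pow_eq_one (by rw [hy, ← map_pow, inl_pow_card, map_one])
  have hconj : inr (ofAdd 1) * y * (inr (ofAdd 1))⁻¹ = y ^ (b : ZMod m).val := by
    rw [hyl, conj_inl, ← map_pow]
    congr 1
    apply toAdd.injective
    simp [unitMulAut_apply]
  have himg := congrArg f hconj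
  rw [map_mul, map_mul, map_inv, map_pow, hy, f.apply_symm_apply, conj_inl, ← map_pow,
    inl_inj] at himg
  have key : ((unitMulAut c ^ (f (inr (ofAdd 1))).right.toAdd) (ofAdd 1)).toAdd = (b : ZMod m) := by
    simpa using congrArg toAdd himg
  rcases Int.isUnit_iff.mp (isUnit_right_map_inr f) with h | h
  · left
    ext
    simpa [h, unitMulAut_apply] using key.symm
  · right
    ext
    rw [h, zpow_neg_one, unitMulAut_inv] at key
    simpa [unitMulAut_apply] using key.symm

end zmodSemidirectZ

/-- `(ℤ/11ℤ) ⋊_4 ℤ` and `(ℤ/11ℤ) ⋊_9 ℤ` are not isomorphic as groups. -/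
theorem statement11 :
    IsEmpty
      (zmodSemidirectZ 11 (ZMod.unitOfCoprime 4 (by norm_num)) ≃*
        zmodSemidirectZ 11 (ZMod.unitOfCoprime 9 (by norm_num))) := by
  refine ⟨fun f => ?_⟩
  rcases zmodSemidirectZ.eq_or_eq_inv_of_mulEquiv f with h | h
  · exact absurd (congrArg Units.val h) (by simp only [ZMod.coe_unitOfCoprime]; decide)
  · rw [eq_inv_iff_mul_eq_one] at h
    refine absurd (congrArg Units.val h) ?_
    simp only [Units.val_mul, ZMod.coe_unitOfCoprime]
    decide
end

section
/- Let A be a group such that every group homomorphism from A to ℤ is trivial. Let κ₁, κ₂ be automorphisms of A, and let κ̄₁, κ̄₂ denote their images in the outer automorphism group Out(A) = Aut(A)/Inn(A). If κ̄₁ is conjugate in Out(A) to neither κ̄₂ nor κ̄₂⁻¹, then the semidirect products A ⋊_{κ₁} ℤ and A ⋊_{κ₂} ℤ are not isomorphic as groups. -/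
/-- The subgroup of inner automorphisms is normal in the automorphism group. -/
instance innNormal (A : Type*) [Group A] : ((MulAut.conj : A →* MulAut A).range).Normal := by
  constructor
  intro x hx κ
  obtain ⟨a, rfl⟩ := hx
  refine ⟨κ a, ?_⟩
  ext b
  simp [mul_assoc]

namespace SemidirectProduct

variable {N N' G G' : Type*} [Group N] [Group N'] [Group G] [Group G']
  {φ : G →* MulAut N} {ψ : G' →* MulAut N'}

theorem inl_left_of_right_eq_one {x : N ⋊[φ] G} (hx : x.right = 1) : inl x.left = x :=
  SemidirectProduct.ext (by simp) (by simp [hx])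

/-- An isomorphism of semidirect products that preserves the kernels of the projections
restricts to an isomorphism of these kernels. -/
def kernelEquiv (e : N ⋊[φ] G ≃* N' ⋊[ψ] G') (he : ∀ n, (e (inl n)).right = 1)
    (he' : ∀ n, (e.symm (inl n)).right = 1) : N ≃* N' where
  toFun n := (e (inl n)).left
  invFun n := (e.symm (inl n)).left
  left_inv n := by simp [inl_left_of_right_eq_one (he n)]
  right_inv n := by simp [inl_left_of_right_eq_one (he' n)]
  map_mul' m n := by simp [he m]

theorem inl_kernelEquiv (e : N ⋊[φ] G ≃* N' ⋊[ψ] G') (he : ∀ n, (e (inl n)).right = 1)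
    (he' : ∀ n, (e.symm (inl n)).right = 1) (n : N) :
    inl (kernelEquiv e he he' n) = e (inl n) :=
  inl_left_of_right_eq_one (he n)

theorem kernelEquiv_aut (e : N ⋊[φ] G ≃* N' ⋊[ψ] G') (he : ∀ n, (e (inl n)).right = 1)
    (he' : ∀ n, (e.symm (inl n)).right = 1) (g : G) (n : N) :
    kernelEquiv e he he' (φ g n) =
      MulAut.conj (e (inr g)).left (ψ (e (inr g)).right (kernelEquiv e he he' n)) := by
  apply inl_injective (φ := ψ)
  rw [inl_kernelEquiv, inl_aut, map_mul, map_mul, map_inv, map_inv, ← inl_kernelEquiv e he he']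
  ext <;> simp [mul_assoc]

theorem right_map_inr_surjective (e : N ⋊[φ] G ≃* N' ⋊[ψ] G')
    (he : ∀ n, (e (inl n)).right = 1) :
    Function.Surjective (fun g => (e (inr g)).right) := by
  intro g
  obtain ⟨x, hx⟩ := e.surjective (inr g)
  refine ⟨x.right, ?_⟩
  rw [← inl_left_mul_inr_right x, map_mul] at hx
  simpa [he] using congrArg SemidirectProduct.right hx

end SemidirectProduct

/-- A surjective endomorphism of the infinite cyclic group maps the generator to a generator. -/
theorem map_ofAdd_one_of_surjective (f : Multiplicative ℤ →* Multiplicative ℤ)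
    (hf : Function.Surjective f) :
    f (Multiplicative.ofAdd 1) = Multiplicative.ofAdd 1 ∨
      f (Multiplicative.ofAdd 1) = Multiplicative.ofAdd (-1) := by
  obtain ⟨z, hz⟩ := hf (Multiplicative.ofAdd 1)
  have hmul : z.toAdd * (f (Multiplicative.ofAdd 1)).toAdd = 1 := by
    have h : z = Multiplicative.ofAdd 1 ^ z.toAdd := by simp [← ofAdd_zsmul]
    rw [h, map_zpow] at hz
    simpa using congrArg Multiplicative.toAdd hz
  exact Int.isUnit_iff.mp (IsUnit.of_mul_eq_one_right _ hmul)

/-- Let `A` be a group with no nontrivial homomorphism to `ℤ`, and let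
`κ₁, κ₂` be automorphisms of `A` whose class `κ̄₁` in `Out(A) = Aut(A)/Inn(A)` is conjugate to
neither `κ̄₂` nor `κ̄₂⁻¹`.  Then the semidirect products `A ⋊_{κ₁} ℤ` and `A ⋊_{κ₂} ℤ` are not
isomorphic. -/
theorem statement12 {A : Type} [Group A]
    (hA : ∀ χ : A →* Multiplicative ℤ, χ = 1)
    (κ₁ κ₂ : MulAut A)
    (h₁ : ¬ IsConj
      (QuotientGroup.mk κ₁ : MulAut A ⧸ (MulAut.conj : A →* MulAut A).range)
      (QuotientGroup.mk κ₂))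
    (h₂ : ¬ IsConj
      (QuotientGroup.mk κ₁ : MulAut A ⧸ (MulAut.conj : A →* MulAut A).range)
      ((QuotientGroup.mk κ₂)⁻¹)) :
    IsEmpty
      ((A ⋊[zpowersHom (MulAut A) κ₁] Multiplicative ℤ) ≃*
        (A ⋊[zpowersHom (MulAut A) κ₂] Multiplicative ℤ)) := by
  refine ⟨fun e => ?_⟩
  have he (n : A) : (e (SemidirectProduct.inl n)).right = 1 :=
    DFunLike.congr_fun (hA (SemidirectProduct.rightHom.comp
      (e.toMonoidHom.comp SemidirectProduct.inl))) n
  have he' (n : A) : (e.symm (SemidirectProduct.inl n)).right = 1 :=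
    DFunLike.congr_fun (hA (SemidirectProduct.rightHom.comp
      (e.symm.toMonoidHom.comp SemidirectProduct.inl))) n
  let α : MulAut A := SemidirectProduct.kernelEquiv e he he'
  let s := e (SemidirectProduct.inr (Multiplicative.ofAdd 1))
  have hα : α * κ₁ = MulAut.conj s.left * zpowersHom (MulAut A) κ₂ s.right * α := by
    ext n
    simpa using SemidirectProduct.kernelEquiv_aut e he he' (Multiplicative.ofAdd 1) n
  have hconj : IsConj
      (QuotientGroup.mk κ₁ : MulAut A ⧸ (MulAut.conj : A →* MulAut A).range)
      (QuotientGroup.mk (zpowersHom (MulAut A) κ₂ s.right)) := by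
    refine isConj_iff.mpr ⟨QuotientGroup.mk α, mul_inv_eq_of_eq_mul ?_⟩
    have hinner : (QuotientGroup.mk (MulAut.conj s.left) :
        MulAut A ⧸ (MulAut.conj : A →* MulAut A).range) = 1 :=
      (QuotientGroup.eq_one_iff _).mpr ⟨s.left, rfl⟩
    rw [← QuotientGroup.mk_mul, hα, QuotientGroup.mk_mul, QuotientGroup.mk_mul, hinner, one_mul]
  rcases map_ofAdd_one_of_surjective
    (SemidirectProduct.rightHom.comp (e.toMonoidHom.comp SemidirectProduct.inr))
    (SemidirectProduct.right_map_inr_surjective e he) with h | h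
  · have hs : s.right = Multiplicative.ofAdd 1 := h
    exact h₁ (by simpa [hs] using hconj)
  · have hs : s.right = Multiplicative.ofAdd (-1) := h
    exact h₂ (by simpa [hs] using hconj)
end

section
/- Let A be a group such that every group homomorphism from A to ℤ is trivial, and let κ₁, κ₂ be automorphisms of A. Then every group isomorphism λ : A ⋊_{κ₁} ℤ → A ⋊_{κ₂} ℤ maps the canonical copy of A in A ⋊_{κ₁} ℤ onto the canonical copy of A in A ⋊_{κ₂} ℤ. -/
theorem SemidirectProduct.map_range_inl_le_of_forall_hom_eq_one {N₁ N₂ G₁ G₂ : Type*}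
    [Group N₁] [Group N₂] [Group G₁] [Group G₂] {φ₁ : G₁ →* MulAut N₁} {φ₂ : G₂ →* MulAut N₂}
    (h : ∀ χ : N₁ →* G₂, χ = 1) (f : N₁ ⋊[φ₁] G₁ →* N₂ ⋊[φ₂] G₂) :
    Subgroup.map f (inl : N₁ →* N₁ ⋊[φ₁] G₁).range ≤ (inl : N₂ →* N₂ ⋊[φ₂] G₂).range := by
  rw [range_inl_eq_ker_rightHom (φ := φ₂)]
  rintro _ ⟨_, ⟨a, rfl⟩, rfl⟩
  exact DFunLike.congr_fun (h ((rightHom.comp f).comp inl)) a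

/-- Let `A` be a group with no nontrivial homomorphism to `ℤ`, and let
`κ₁, κ₂` be automorphisms of `A`.  Then every isomorphism `λ : A ⋊_{κ₁} ℤ → A ⋊_{κ₂} ℤ` maps the
canonical copy of `A` in `A ⋊_{κ₁} ℤ` onto the canonical copy of `A` in `A ⋊_{κ₂} ℤ`. -/
theorem statement14 {A : Type} [Group A]
    (hA : ∀ χ : A →* Multiplicative ℤ, χ = 1)
    (κ₁ κ₂ : MulAut A)
    (lam : (A ⋊[zpowersHom (MulAut A) κ₁] Multiplicative ℤ) ≃*
      (A ⋊[zpowersHom (MulAut A) κ₂] Multiplicative ℤ)) :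
    Subgroup.map lam.toMonoidHom
        (SemidirectProduct.inl : A →* A ⋊[zpowersHom (MulAut A) κ₁] Multiplicative ℤ).range =
      (SemidirectProduct.inl : A →* A ⋊[zpowersHom (MulAut A) κ₂] Multiplicative ℤ).range := by
  refine le_antisymm
    (SemidirectProduct.map_range_inl_le_of_forall_hom_eq_one hA lam.toMonoidHom) fun x hx => ?_
  exact ⟨lam.symm x, SemidirectProduct.map_range_inl_le_of_forall_hom_eq_one hA
    lam.symm.toMonoidHom ⟨x, hx, rfl⟩, lam.apply_symm_apply x⟩
end

section
/- Let A be a group such that every group homomorphism from A to ℤ is trivial, and let κ₁, κ₂ be automorphisms of A. If the semidirect products A ⋊_{κ₁} ℤ and A ⋊_{κ₂} ℤ are isomorphic as groups, then there exists e ∈ {1, -1} such that the image of κ₁ in Out(A) = Aut(A)/Inn(A) is conjugate in Out(A) to the image of κ₂^e. -/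
namespace SemidirectProduct

variable {A G : Type*} [Group A] [Group G] {φ₁ φ₂ : G →* MulAut A}

/-- If every homomorphism `A →* G` is trivial, then homomorphisms between semidirect products
of `A` by `G` preserve `A`. -/
theorem map_inl_eq (hA : ∀ χ : A →* G, χ = 1) (θ : A ⋊[φ₁] G →* A ⋊[φ₂] G) (a : A) :
    θ (inl a) = inl (θ (inl a)).left := by
  have h := DFunLike.congr_fun (hA ((rightHom.comp θ).comp inl)) a
  exact SemidirectProduct.ext rfl h

/-- If every homomorphism `A →* G` is trivial, then an isomorphism between semidirect products
of `A` by `G` restricts to an automorphism of `A`. -/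
theorem exists_mulAut_of_mulEquiv (hA : ∀ χ : A →* G, χ = 1) (θ : A ⋊[φ₁] G ≃* A ⋊[φ₂] G) :
    ∃ α : MulAut A, ∀ a, θ (inl a) = inl (α a) := by
  have h₁ := map_inl_eq hA θ.toMonoidHom
  have h₂ := map_inl_eq hA θ.symm.toMonoidHom
  simp only [MulEquiv.toMonoidHom_eq_coe, MonoidHom.coe_coe] at h₁ h₂
  refine ⟨{ toFun := fun a => (θ (inl a)).left
            invFun := fun a => (θ.symm (inl a)).left
            left_inv := fun a => ?_
            right_inv := fun a => ?_
            map_mul' := fun a b => ?_ }, h₁⟩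
  · simp [← h₁]
  · simp [← h₂]
  · apply inl_injective (φ := φ₂)
    rw [← h₁, map_mul, map_mul, map_mul, ← h₁, ← h₁]

/-- If every homomorphism `A →* G` is trivial, then an isomorphism between semidirect products
of `A` by `G` induces a surjection on the quotients `G`. -/
theorem surjective_rightHom_comp_inr (hA : ∀ χ : A →* G, χ = 1)
    (θ : A ⋊[φ₁] G ≃* A ⋊[φ₂] G) :
    Function.Surjective ((rightHom.comp θ.toMonoidHom).comp inr) := by
  intro g
  obtain ⟨x, hx⟩ := θ.surjective (inr g)
  refine ⟨x.right, ?_⟩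
  obtain ⟨α, hα⟩ := exists_mulAut_of_mulEquiv hA θ
  rw [← inl_left_mul_inr_right x, map_mul, hα] at hx
  simpa using congrArg SemidirectProduct.right hx

/-- If every homomorphism `A →* G` is trivial, then an isomorphism between semidirect products
of `A` by `G` intertwines the outer actions of `G` up to conjugacy. -/
theorem isConj_mk_of_mulEquiv (hA : ∀ χ : A →* G, χ = 1) (θ : A ⋊[φ₁] G ≃* A ⋊[φ₂] G) (g : G) :
    IsConj (QuotientGroup.mk (φ₁ g) : MulAut A ⧸ (MulAut.conj : A →* MulAut A).range)
      (QuotientGroup.mk (φ₂ (θ (inr g)).right)) := by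
  obtain ⟨α, hα⟩ := exists_mulAut_of_mulEquiv hA θ
  have key : α * φ₁ g * α⁻¹ = MulAut.conj (θ (inr g)).left * φ₂ (θ (inr g)).right := by
    rw [mul_inv_eq_iff_eq_mul]
    ext a
    apply inl_injective (φ := φ₂)
    rw [MulAut.mul_apply, ← hα, inl_aut, map_mul, map_mul, hα, map_inv, map_inv]
    ext <;> simp [mul_assoc]
  have hconj : (QuotientGroup.mk (MulAut.conj (θ (inr g)).left) :
      MulAut A ⧸ (MulAut.conj : A →* MulAut A).range) = 1 :=
    (QuotientGroup.eq_one_iff _).2 ⟨_, rfl⟩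
  rw [isConj_iff]
  refine ⟨QuotientGroup.mk α, ?_⟩
  rw [← QuotientGroup.mk_inv, ← QuotientGroup.mk_mul, ← QuotientGroup.mk_mul, key,
    QuotientGroup.mk_mul, hconj, one_mul]

end SemidirectProduct

/-- A surjective endomorphism of `ℤ` sends `1` to `1` or `-1`. -/
theorem toAdd_map_ofAdd_one_of_surjective (f : Multiplicative ℤ →* Multiplicative ℤ)
    (hf : Function.Surjective f) :
    (f (Multiplicative.ofAdd 1)).toAdd = 1 ∨ (f (Multiplicative.ofAdd 1)).toAdd = -1 := by
  obtain ⟨n, hn⟩ := hf (Multiplicative.ofAdd 1)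
  rw [MonoidHom.apply_mint _ f n] at hn
  have h := congrArg Multiplicative.toAdd hn
  rw [toAdd_zpow, smul_eq_mul, mul_comm, toAdd_ofAdd] at h
  exact Int.eq_one_or_neg_one_of_mul_eq_one h

/-- Let `A` be a group with no nontrivial homomorphism to `ℤ`, and let
`κ₁, κ₂` be automorphisms of `A`.  If `A ⋊_{κ₁} ℤ` and `A ⋊_{κ₂} ℤ` are isomorphic, then there
is `e ∈ {1, -1}` such that the image of `κ₁` in `Out(A) = Aut(A)/Inn(A)` is conjugate in `Out(A)`
to the image of `κ₂ ^ e`. -/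
theorem statement15 {A : Type} [Group A]
    (hA : ∀ χ : A →* Multiplicative ℤ, χ = 1)
    (κ₁ κ₂ : MulAut A)
    (h : Nonempty
      ((A ⋊[zpowersHom (MulAut A) κ₁] Multiplicative ℤ) ≃*
        (A ⋊[zpowersHom (MulAut A) κ₂] Multiplicative ℤ))) :
    ∃ e : ℤ, (e = 1 ∨ e = -1) ∧
      IsConj
        (QuotientGroup.mk κ₁ : MulAut A ⧸ (MulAut.conj : A →* MulAut A).range)
        (QuotientGroup.mk (κ₂ ^ e)) := by
  obtain ⟨θ⟩ := h
  refine ⟨_, toAdd_map_ofAdd_one_of_surjective _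
    (SemidirectProduct.surjective_rightHom_comp_inr hA θ), ?_⟩
  simpa [zpowersHom_apply] using
    SemidirectProduct.isConj_mk_of_mulEquiv hA θ (Multiplicative.ofAdd 1)
end
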